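/- Let $T>0$ and let $\widetilde{\omegaup}\subset\mathbb{T}^2$ be a set with nonempty interior. There exists a function $\overline{y}\in C^\infty_0((0,T);\mathbb{R}^2)$ (a smooth, compactly supported, space-independent vector field) such that the flow $\Phi^{\overline{y}}$, defined by $\frac{d}{dt}\Phi^{\overline{y}}(x;s,t)=\overline{y}(t)$ and $\Phi^{\overline{y}}(x;s,s)=x$, satisfies $\Phi^{\overline{y}}(x;0,T)=x$ for all $x\in\mathbb{T}^2$, and for every $x\in\mathbb{T}^2$ there exists $t_x\in(0,T)$ with $\Phi^{\overline{y}}(x;0,t_x)\in\widetilde{\omegaup}$. -/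

import Mathlib

noncomputable section
open MeasureTheory Real Filter Topology

/-- Points of `ℝ^d`; the torus `𝕋^d = ℝ^d / 2πℤ^d` is modelled via `2π`-periodic
functions on `ℝ^d`. -/
abbrev Pt (d : ℕ) := EuclideanSpace ℝ (Fin d)

/-- A function on `ℝ^d` descends to the torus `𝕋^d`. -/
def IsPeriodic {d : ℕ} {E : Type*} (f : Pt d → E) : Prop :=
  ∀ (x : Pt d) (i : Fin d), f (x + (2 * π) • EuclideanSpace.single i (1 : ℝ)) = f x

/-- A fundamental domain for the torus. -/
def box (d : ℕ) : Set (Pt d) := {x | ∀ i, x i ∈ Set.Ico (0 : ℝ) (2 * π)}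

/-- Average of a scalar function over the torus. -/
def avg {d : ℕ} (f : Pt d → ℝ) : ℝ := (∫ x in box d, f x) / (2 * π) ^ d

/-- The `L²(𝕋^d)` norm. -/
def L2Norm {d : ℕ} {E : Type*} [NormedAddCommGroup E] (f : Pt d → E) : ℝ :=
  Real.sqrt (∫ x in box d, ‖f x‖ ^ 2)

/-- The Sobolev `H^k(𝕋^d)` norm. -/
def HNorm {d : ℕ} {E : Type*} [NormedAddCommGroup E] [NormedSpace ℝ E]
    (k : ℕ) (f : Pt d → E) : ℝ :=
  Real.sqrt (∑ i ∈ Finset.range (k + 1), ∫ x in box d, ‖iteratedFDeriv ℝ i f x‖ ^ 2)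

/-- Partial derivative `∂ᵢ f` of a scalar function. -/
def pd {d : ℕ} (i : Fin d) (f : Pt d → ℝ) (x : Pt d) : ℝ :=
  fderiv ℝ f x (EuclideanSpace.single i (1 : ℝ))

/-- Laplacian of a scalar function. -/
def lap {d : ℕ} (f : Pt d → ℝ) (x : Pt d) : ℝ := ∑ i, pd i (pd i f) x

/-- `(v · ∇) f` for a vector field `v` and a scalar function `f`. -/
def dotGrad {d : ℕ} (v : Pt d → Pt d) (f : Pt d → ℝ) (x : Pt d) : ℝ :=
  ∑ i, v x i * pd i f x

/-- A vector field is divergence free. -/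
def DivFree {d : ℕ} (v : Pt d → Pt d) : Prop :=
  ∀ x, (∑ i, pd i (fun y => v y i) x) = 0

/-- A vector field has zero average over the torus. -/
def ZeroAvgV {d : ℕ} (v : Pt d → Pt d) : Prop := ∀ i, (∫ x in box d, v x i) = 0

/-- Membership in `H^k(𝕋^d; E)` (classical-regularity encoding). -/
def MemH {d : ℕ} {E : Type*} [NormedAddCommGroup E] [NormedSpace ℝ E]
    (k : ℕ) (f : Pt d → E) : Prop := IsPeriodic f ∧ ContDiff ℝ k f

/-- Membership in the zero-average scalar Sobolev space `H^k` of the paper. -/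
def MemHs {d : ℕ} (k : ℕ) (f : Pt d → ℝ) : Prop :=
  MemH k f ∧ (∫ x in box d, f x) = 0

/-- Membership in `H^k_σ`: divergence-free, zero-average vector fields. -/
def MemHσ {d : ℕ} (k : ℕ) (v : Pt d → Pt d) : Prop :=
  MemH k v ∧ DivFree v ∧ ZeroAvgV v

/-- `f ∈ C(J; H^k)`: membership for each time together with continuity in the
`H^k` norm. -/
def ContInH {d : ℕ} {E : Type*} [NormedAddCommGroup E] [NormedSpace ℝ E]
    (k : ℕ) (J : Set ℝ) (f : ℝ → Pt d → E) : Prop :=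
  (∀ t ∈ J, MemH k (f t)) ∧
  ∀ t₀ ∈ J, Tendsto (fun t => HNorm k (fun x => f t x - f t₀ x)) (nhdsWithin t₀ J) (nhds 0)

/-- The `C(J_T; H^k)` norm: sup in time of the `H^k` norm. -/
def CHNorm {d : ℕ} {E : Type*} [NormedAddCommGroup E] [NormedSpace ℝ E]
    (k : ℕ) (T : ℝ) (f : ℝ → Pt d → E) : ℝ :=
  ⨆ t : Set.Icc (0 : ℝ) T, HNorm k (f t.1)

/-- The relaxation norm `|||v|||_{T,k} = sup_{t ∈ [0,T]} ‖∫_0^t v(s) ds‖_{H^k}`. -/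
def RelaxNorm {d : ℕ} {E : Type*} [NormedAddCommGroup E] [NormedSpace ℝ E]
    [CompleteSpace E] (k : ℕ) (T : ℝ) (f : ℝ → Pt d → E) : ℝ :=
  ⨆ t : Set.Icc (0 : ℝ) T, HNorm k (fun x => ∫ s in Set.Ioc (0 : ℝ) t.1, f s x)

/-- A subset of `ℝ²` descending to the torus `𝕋²`. -/
def IsPeriodicSet (S : Set (Pt 2)) : Prop :=
  ∀ (x : Pt 2) (i : Fin 2),
    x + (2 * π) • EuclideanSpace.single i (1 : ℝ) ∈ S ↔ x ∈ S

theorem periodicSet_int (S : Set (Pt 2)) (h : IsPeriodicSet S) (i : Fin 2) (k : ℤ) (x : Pt 2) :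
    x + (2 * π * k) • EuclideanSpace.single i (1 : ℝ) ∈ S ↔ x ∈ S := by
  induction k using Int.induction_on with
  | zero => simp
  | succ n ih =>
    rw [← ih, ← h (x + (2 * π * ((n : ℤ) : ℝ)) • EuclideanSpace.single i (1 : ℝ)) i]
    rw [add_assoc, ← add_smul]
    push_cast
    ring_nf
  | pred n ih =>
    rw [← ih, ← h (x + (2 * π * ((-(n : ℤ) - 1 : ℤ) : ℝ)) • EuclideanSpace.single i (1 : ℝ)) i]
    rw [add_assoc, ← add_smul]
    push_cast
    ring_nf

/-- **return-method trajectory.** For `T > 0` and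
`ω̃ ⊂ 𝕋²` with nonempty interior, there is a space-independent field
`ȳ ∈ C_0^∞((0,T); ℝ²)` whose flow `Φ^ȳ` satisfies `Φ^ȳ(x;0,T) = x` for every
`x` and flushes every point through `ω̃`: for every `x` some `t_x ∈ (0,T)`
has `Φ^ȳ(x;0,t_x) ∈ ω̃`. -/
theorem statement15 (T : ℝ) (hT : 0 < T)
    (ω' : Set (Pt 2)) (hω_per : IsPeriodicSet ω')
    (hω_int : (interior ω').Nonempty) :
    ∃ y : ℝ → Pt 2, ContDiff ℝ (⊤ : ℕ∞) y ∧ tsupport y ⊆ Set.Ioo 0 T ∧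
      ∀ Φ : Pt 2 → ℝ → ℝ → Pt 2,
        ((∀ x s, Φ x s s = x) ∧
          ∀ x s t, HasDerivAt (Φ x s) (y t) t) →
        (∀ x, Φ x 0 T = x) ∧ ∀ x, ∃ t ∈ Set.Ioo 0 T, Φ x 0 t ∈ ω' := by
  obtain ⟨c, hc⟩ := hω_int
  obtain ⟨r, hr, hball⟩ := Metric.isOpen_iff.mp isOpen_interior c hc
  have hball' : Metric.ball c r ⊆ ω' := hball.trans interior_subset
  have hpi := Real.pi_pos
  obtain ⟨n, hn⟩ := exists_nat_gt (2 * π / r + 1)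
  set N : ℝ := (n : ℝ) with hN
  have hd : 0 < 2 * π / r := by positivity
  have hN1 : 1 < N := by linarith
  have hN0 : 0 < N := by linarith
  have hNr : 2 * π / N < r := by
    rw [div_lt_iff₀ hN0]
    have : 2 * π / r < N := by linarith
    rw [div_lt_iff₀ hr] at this
    linarith
  let f : ContDiffBump (T / 2) := ⟨T / 8, T / 4, by positivity, by linarith⟩
  have hfs : tsupport f ⊆ Set.Ioo 0 T := by
    rw [f.tsupport_eq]
    intro t ht
    rw [Metric.mem_closedBall, Real.dist_eq, abs_le] at ht
    have h4 : f.rOut = T / 4 := rfl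
    rw [h4] at ht
    constructor <;> linarith [ht.1, ht.2]
  let v : Pt 2 := !₂[1, N]
  let γ : ℝ → Pt 2 := fun t => (6 * π * f t) • v
  have hγ : ContDiff ℝ (⊤ : ℕ∞) γ := (contDiff_const.mul f.contDiff).smul contDiff_const
  have hz : ∀ t, t ∉ Set.Ioo 0 T → f t = 0 := fun t ht => image_eq_zero_of_notMem_tsupport
    (fun h => ht (hfs h))
  refine ⟨deriv γ, ?_, ?_, ?_⟩
  · exact (contDiff_infty_iff_deriv.mp hγ).2
  · refine (closure_minimal ?_ (isClosed_tsupport γ) : tsupport (deriv γ) ⊆ tsupport γ).trans ?_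
    · exact support_deriv_subset
    · refine (closure_mono ?_).trans hfs
      intro t ht h0
      apply ht
      simp only [γ]
      rw [h0]
      simp
  · rintro Φ ⟨h0, hder⟩
    have hγd : Differentiable ℝ γ := hγ.differentiable (by simp)
    have key : ∀ x t, Φ x 0 t = x + γ t := by
      intro x t
      have hD : ∀ u, HasDerivAt (fun u => Φ x 0 u - γ u) 0 u := by
        intro u
        have := (hder x 0 u).sub (hγd u).hasDerivAt
        rw [sub_self] at this
        exact this
      have := is_const_of_deriv_eq_zero (fun u => (hD u).differentiableAt)
        (fun u => (hD u).deriv) t 0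
      simp only [h0] at this
      have hg0 : γ 0 = 0 := by
        simp only [γ]
        rw [hz 0 (by simp)]
        simp
      rw [hg0, sub_zero] at this
      exact sub_eq_iff_eq_add.mp this
    constructor
    · intro x
      rw [key]
      simp only [γ]
      rw [hz T (by simp)]
      simp
    · intro x
      obtain ⟨m, hm, -⟩ := existsUnique_add_zsmul_mem_Ico (show 0 < 2 * π by positivity)
        (c 0 - x 0) (2 * π)
      set A : ℝ := c 0 - x 0 + m • (2 * π) with hA
      obtain ⟨k, hk, -⟩ := existsUnique_add_zsmul_mem_Ico (show 0 < 2 * π by positivity)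
        (c 1 - x 1) (N * A)
      set B : ℝ := c 1 - x 1 + k • (2 * π) with hB
      have h1 : A ≤ B / N := by
        rw [le_div_iff₀ hN0]
        linarith [hk.1]
      have h2 : B / N < A + 2 * π / N := by
        rw [div_lt_iff₀ hN0, add_mul, div_mul_cancel₀ _ hN0.ne']
        linarith [hk.2]
      have h3 : 2 * π / N < 2 * π := by
        rw [div_lt_iff₀ hN0]
        nlinarith
      have hpos : 0 < B / N := by linarith [hm.1]
      have hlt : B / N ≤ 6 * π := by linarith [hm.2]
      have hcont : Continuous (fun t => 6 * π * f t) := continuous_const.mul f.continuous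
      obtain ⟨t, ht⟩ : B / N ∈ Set.range (fun t => 6 * π * f t) := by
        apply mem_range_of_exists_le_of_exists_ge hcont
        · refine ⟨0, ?_⟩
          rw [hz 0 (by simp)]
          simpa using hpos.le
        · refine ⟨T / 2, ?_⟩
          rw [f.one_of_mem_closedBall, mul_one]
          · exact hlt
          · exact Metric.mem_closedBall_self f.rIn_pos.le
      simp only at ht
      have htI : t ∈ Set.Ioo 0 T := by
        by_contra h
        rw [hz t h] at ht
        linarith
      refine ⟨t, htI, ?_⟩
      rw [key]
      have hpt : x + γ t = c + (B / N - A) • EuclideanSpace.single (0 : Fin 2) (1 : ℝ)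
          + (2 * π * (m : ℝ)) • EuclideanSpace.single (0 : Fin 2) (1 : ℝ)
          + (2 * π * (k : ℝ)) • EuclideanSpace.single (1 : Fin 2) (1 : ℝ) := by
        ext j
        fin_cases j
        · simp [γ, v, ht, hA]
          ring
        · simp [γ, v, ht]
          rw [div_mul_cancel₀ _ hN0.ne', hB]
          simp
          ring
      rw [hpt, periodicSet_int _ hω_per, periodicSet_int _ hω_per]
      apply hball'
      rw [Metric.mem_ball, dist_eq_norm, add_sub_cancel_left, norm_smul,
        EuclideanSpace.norm_single, norm_one, mul_one, Real.norm_eq_abs, abs_lt]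
      constructor <;> linarith
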